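/- Let d ≥ 2, let A ⊆ ℤ^d be finite, and let y be a site of the site perimeter of A. Then −1 ≤ N(A ∪ {y}) − N(A) ≤ 2(d−1). (This is the homology-free form, via Alexander duality, of the i = d−1 case of Theorem 2.3: adding one tile to a polyomino changes the top-dimensional Betti number β_{d−1} by at least −2^{d−1−i}·C(d−1,i) = −1 and at most 2^{d−i}·C(d−1,i−1) = 2(d−1).) -/

import Mathlib

/-- Grid-graph adjacency on `ℤ^d`: `x` and `y` are adjacent iff `∑ i |x i - y i| = 1`. -/
def gridAdj {d : ℕ} (x y : Fin d → ℤ) : Prop := (∑ i, |x i - y i|) = 1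

/-- `y` is reachable from `x` by a lattice path avoiding `A`. -/
def ReachOutside {d : ℕ} (A : Set (Fin d → ℤ)) (x y : Fin d → ℤ) : Prop :=
  ∃ p : List (Fin d → ℤ),
    List.Chain gridAdj x p ∧ (x :: p).getLast (by simp) = y ∧ ∀ z ∈ x :: p, z ∉ A

/-- The connected component of `x` in the subgraph of the grid graph induced on `ℤ^d \ A`. -/
def compOutside {d : ℕ} (A : Set (Fin d → ℤ)) (x : Fin d → ℤ) : Set (Fin d → ℤ) :=
  {y | ReachOutside A x y}

/-- A void of `A`: a finite connected component of the subgraph of the grid graph induced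
on the complement of `A`. -/
def IsVoid {d : ℕ} (A : Set (Fin d → ℤ)) (V : Set (Fin d → ℤ)) : Prop :=
  ∃ x : Fin d → ℤ, x ∉ A ∧ V = compOutside A x ∧ V.Finite

/-- The number of voids of `A`. -/
noncomputable def numVoids {d : ℕ} (A : Set (Fin d → ℤ)) : ℕ :=
  {V : Set (Fin d → ℤ) | IsVoid A V}.ncard

/-- The site perimeter of `A`: the sites outside `A` adjacent in the grid graph to a site
of `A`. -/
def sitePerimeter {d : ℕ} (A : Set (Fin d → ℤ)) : Set (Fin d → ℤ) :=
  {y | y ∉ A ∧ ∃ x ∈ A, gridAdj x y}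

section helpers
variable {d : ℕ}

def stepOut (A : Set (Fin d → ℤ)) (a b : Fin d → ℤ) : Prop := gridAdj a b ∧ a ∉ A ∧ b ∉ A

theorem gridAdj_symm' {x y : Fin d → ℤ} (h : gridAdj x y) : gridAdj y x := by
  unfold gridAdj at *
  rw [← h]
  exact Finset.sum_congr rfl fun i _ => abs_sub_comm _ _

theorem gridAdj_ne {x y : Fin d → ℤ} (h : gridAdj x y) : x ≠ y := by
  rintro rfl
  simp [gridAdj] at h

theorem reach_iff (A : Set (Fin d → ℤ)) (x y : Fin d → ℤ) :
    ReachOutside A x y ↔ x ∉ A ∧ Relation.ReflTransGen (stepOut A) x y := by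
  constructor
  · rintro ⟨p, hc, hl, hz⟩
    refine ⟨hz x (by simp), ?_⟩
    induction p generalizing x with
    | nil => simp at hl; subst hl; exact .refl
    | cons a p ih =>
      have hc' : gridAdj x a ∧ List.IsChain gridAdj (a :: p) := by
        have hc2 : List.IsChain gridAdj (x :: a :: p) := hc
        simpa using hc2
      refine Relation.ReflTransGen.head ⟨hc'.1, hz x (by simp), hz a (by simp)⟩ ?_
      exact ih a hc'.2 (by simpa using hl) (fun z h => hz z (List.mem_cons_of_mem _ h))
  · rintro ⟨hx, h⟩
    induction h using Relation.ReflTransGen.head_induction_on with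
    | refl => exact ⟨[], List.isChain_singleton _, by simp, by simpa using hx⟩
    | head hab _ ih =>
      rename_i a c _
      obtain ⟨p, hc, hl, hz⟩ := ih hab.2.2
      refine ⟨c :: p, ?_, by simpa using hl, ?_⟩
      · have : List.IsChain gridAdj (c :: p) := hc
        show List.IsChain gridAdj (a :: c :: p)
        simp [hab.1, this]
      · intro z h
        rcases List.mem_cons.1 h with rfl | h
        · exact hx
        · exact hz z h

theorem reach_refl {A : Set (Fin d → ℤ)} {x : Fin d → ℤ} (h : x ∉ A) : ReachOutside A x x :=
  (reach_iff _ _ _).2 ⟨h, .refl⟩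

theorem reach_step {A : Set (Fin d → ℤ)} {x z w : Fin d → ℤ} (h : ReachOutside A x z)
    (s : stepOut A z w) : ReachOutside A x w := by
  rw [reach_iff] at *
  exact ⟨h.1, h.2.tail s⟩

theorem reach_trans {A : Set (Fin d → ℤ)} {x z w : Fin d → ℤ} (h : ReachOutside A x z)
    (s : ReachOutside A z w) : ReachOutside A x w := by
  rw [reach_iff] at *
  exact ⟨h.1, h.2.trans s.2⟩

theorem reach_symm {A : Set (Fin d → ℤ)} {x z : Fin d → ℤ} (h : ReachOutside A x z) :
    ReachOutside A z x := by
  have h' := (reach_iff _ _ _).1 h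
  obtain ⟨hx, h'⟩ := h'
  clear h
  induction h' with
  | refl => exact reach_refl hx
  | tail _ s ih =>
    exact reach_trans (reach_step (reach_refl s.2.2) ⟨gridAdj_symm' s.1, s.2.2, s.2.1⟩) ih

theorem comp_eq {A : Set (Fin d → ℤ)} {x z : Fin d → ℤ} (h : ReachOutside A x z) :
    compOutside A x = compOutside A z := by
  ext w
  exact ⟨fun k => reach_trans (reach_symm h) k, fun k => reach_trans h k⟩

theorem reach_mono {A B : Set (Fin d → ℤ)} (hAB : A ⊆ B) {x z : Fin d → ℤ}
    (h : ReachOutside B x z) : ReachOutside A x z := by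
  obtain ⟨p, hc, hl, hz⟩ := h
  exact ⟨p, hc, hl, fun w hw k => hz w hw (hAB k)⟩

theorem reach_split {A : Set (Fin d → ℤ)} {x y z : Fin d → ℤ} (hx : x ∉ A ∪ {y})
    (h : ReachOutside A x z) : ReachOutside (A ∪ {y}) x z ∨ ReachOutside A x y := by
  obtain ⟨hxA, h⟩ := (reach_iff _ _ _).1 h
  induction h with
  | refl => exact .inl (reach_refl hx)
  | tail h1 s ih =>
    rename_i b c
    by_cases hc : c = y
    · right
      rw [← hc]
      exact (reach_iff _ _ _).2 ⟨hxA, h1.tail s⟩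
    by_cases hb : b = y
    · right
      rw [← hb]
      exact (reach_iff _ _ _).2 ⟨hxA, h1⟩
    rcases ih ((reach_iff _ _ _).2 ⟨hxA, h1⟩) with k | k
    · exact .inl (reach_step k ⟨s.1, by simp [s.2.1, hb], by simp [s.2.2, hc]⟩)
    · exact .inr k

theorem comp_same {A : Set (Fin d → ℤ)} {x y : Fin d → ℤ} (hx : x ∉ A ∪ {y})
    (h : ¬ ReachOutside A x y) : compOutside (A ∪ {y}) x = compOutside A x := by
  ext z
  exact ⟨fun k => reach_mono Set.subset_union_left k,
    fun k => (reach_split hx k).resolve_right h⟩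

theorem reach_nbr {A : Set (Fin d → ℤ)} {y z : Fin d → ℤ}
    (h : ReachOutside A y z) :
    z = y ∨ ∃ n, (gridAdj y n ∧ n ∉ A) ∧ ReachOutside (A ∪ {y}) n z := by
  obtain ⟨hxA, h⟩ := (reach_iff _ _ _).1 h
  induction h with
  | refl => exact .inl rfl
  | tail h1 s ih =>
    rename_i b c
    by_cases hc : c = y
    · exact .inl hc
    right
    have hcA : c ∉ A ∪ {y} := by simp [s.2.2, hc]
    by_cases hb : b = y
    · subst hb
      exact ⟨c, ⟨s.1, s.2.2⟩, reach_refl hcA⟩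
    obtain ⟨n, hn, k⟩ := (ih ((reach_iff _ _ _).2 ⟨hxA, h1⟩)).resolve_left hb
    exact ⟨n, hn, reach_step k ⟨s.1, by simp [s.2.1, hb], hcA⟩⟩

theorem nbr_subset (y : Fin d → ℤ) : {n | gridAdj y n} ⊆
    Set.range (fun p : Fin d × Bool =>
      Function.update y p.1 (y p.1 + if p.2 then 1 else -1)) := by
  intro z hz
  have hz : (∑ i, |y i - z i|) = 1 := hz
  obtain ⟨i, -, hi⟩ : ∃ i ∈ Finset.univ, |y i - z i| ≠ 0 := by
    apply Finset.exists_ne_zero_of_sum_ne_zero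
    rw [hz]; exact one_ne_zero
  rw [← Finset.add_sum_erase _ _ (Finset.mem_univ i)] at hz
  have h0 : 0 ≤ ∑ j ∈ Finset.univ.erase i, |y j - z j| := Finset.sum_nonneg fun _ _ => abs_nonneg _
  have h1 := abs_nonneg (y i - z i)
  have hs : ∑ j ∈ Finset.univ.erase i, |y j - z j| = 0 := by omega
  have hi1 : |y i - z i| = 1 := by omega
  have hj : ∀ j, j ≠ i → z j = y j := by
    intro j hji
    have := (Finset.sum_eq_zero_iff_of_nonneg (fun _ _ => abs_nonneg _)).1 hs j (by simp [hji])
    have := abs_eq_zero.1 this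
    omega
  have key : ∀ b : Bool, (z i = y i + if b then 1 else -1) → z ∈ Set.range
      (fun p : Fin d × Bool => Function.update y p.1 (y p.1 + if p.2 then 1 else -1)) := by
    intro b hb
    refine ⟨(i, b), ?_⟩
    funext j
    by_cases h : j = i
    · subst h; simp [hb]
    · simp [h, hj j h]
  rcases (abs_eq one_pos.le).1 hi1 with h | h
  · exact key false (by simp; omega)
  · exact key true (by simp; omega)

theorem nbr_finite (y : Fin d → ℤ) : {n | gridAdj y n}.Finite :=
  (Set.finite_range _).subset (nbr_subset y)

theorem nbr_card (y : Fin d → ℤ) : {n | gridAdj y n}.ncard ≤ 2 * d := by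
  refine (Set.ncard_le_ncard (nbr_subset y) (Set.finite_range _)).trans ?_
  rw [← Set.image_univ]
  refine (Set.ncard_image_le Set.finite_univ).trans ?_
  rw [Set.ncard_univ]
  simp [mul_comm]

end helpers

/-- Adding to a finite set `A ⊆ ℤ^d` (`d ≥ 2`) a site `y` of its site perimeter changes the
number of voids by at least `-1` and at most `2(d-1)`. -/
theorem numVoids_change_bounds {d : ℕ} (hd : 2 ≤ d)
    (A : Set (Fin d → ℤ)) (hA : A.Finite) (y : Fin d → ℤ) (hy : y ∈ sitePerimeter A) :
    -1 ≤ (numVoids (A ∪ {y}) : ℤ) - (numVoids A : ℤ) ∧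
      (numVoids (A ∪ {y}) : ℤ) - (numVoids A : ℤ) ≤ 2 * ((d : ℤ) - 1) := by
  obtain ⟨hyA, x₀, hx₀, hadj⟩ := hy
  set N : Set (Fin d → ℤ) := {n | gridAdj y n ∧ n ∉ A} with hN
  have hNsub : N ⊆ {n | gridAdj y n} \ {x₀} := by
    rintro n ⟨h1, h2⟩
    exact ⟨h1, fun h => h2 (by rw [Set.mem_singleton_iff.1 h]; exact hx₀)⟩
  have hNfin : N.Finite := (nbr_finite y).subset fun n h => h.1
  have hNcard : N.ncard + 1 ≤ 2 * d := by
    have h1 := Set.ncard_le_ncard hNsub ((nbr_finite y).diff)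
    have h2 := Set.ncard_diff_singleton_add_one
      (show x₀ ∈ {n | gridAdj y n} from gridAdj_symm' hadj) (nbr_finite y)
    have := nbr_card y
    omega
  set C := compOutside A y with hC
  set S : Set (Set (Fin d → ℤ)) := {V | IsVoid A V ∧ y ∉ V} with hS
  set P : Set (Set (Fin d → ℤ)) := {V | V.Finite ∧ ∃ n ∈ N, V = compOutside (A ∪ {y}) n} with hP
  have hyC : y ∈ C := reach_refl hyA
  have hPsub : P ⊆ compOutside (A ∪ {y}) '' N := by
    rintro V ⟨-, n, hn, rfl⟩
    exact ⟨n, hn, rfl⟩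
  have hPfin : P.Finite := (hNfin.image _).subset hPsub
  have hSV : S ⊆ {V | IsVoid A V} := fun V h => h.1
  have hVS : {V | IsVoid A V} ⊆ insert C S := by
    rintro V hV
    by_cases h : y ∈ V
    · left
      obtain ⟨x, hx, rfl, hf⟩ := hV
      exact comp_eq h
    · exact .inr ⟨hV, h⟩
  have hSV' : S ⊆ {V | IsVoid (A ∪ {y}) V} := by
    rintro V ⟨⟨x, hx, rfl, hf⟩, hyV⟩
    have hxy : x ≠ y := by
      rintro rfl
      exact hyV (reach_refl hx)
    have hx' : x ∉ A ∪ {y} := by simp [hx, hxy]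
    exact ⟨x, hx', (comp_same hx' hyV).symm, hf⟩
  have hV'S : {V | IsVoid (A ∪ {y}) V} ⊆ S ∪ P := by
    rintro V ⟨x, hx, rfl, hf⟩
    have hxA : x ∉ A := fun h => hx (.inl h)
    have hxy : x ≠ y := fun h => hx (.inr h)
    by_cases h : ReachOutside A x y
    · right
      obtain ⟨n, hn, k⟩ := (reach_nbr (reach_symm h)).resolve_left hxy
      exact ⟨hf, n, hn, (comp_eq k).symm⟩
    · left
      rw [comp_same hx h] at hf ⊢
      exact ⟨⟨x, hxA, rfl, hf⟩, h⟩
  unfold numVoids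
  by_cases hSf : S.Finite
  · have hVf : {V | IsVoid A V}.Finite := (hSf.insert C).subset hVS
    have hV'f : {V | IsVoid (A ∪ {y}) V}.Finite := (hSf.union hPfin).subset hV'S
    have a1 := Set.ncard_le_ncard hVS (hSf.insert C)
    have a2 := Set.ncard_insert_le C S
    have a3 := Set.ncard_le_ncard hSV' hV'f
    have a4 := Set.ncard_le_ncard hV'S (hSf.union hPfin)
    have a5 := Set.ncard_union_le S P
    refine ⟨by omega, ?_⟩
    by_cases hCf : C.Finite
    · have b1 : insert C S ⊆ {V | IsVoid A V} :=
        Set.insert_subset ⟨y, hyA, rfl, hCf⟩ hSV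
      have b2 := Set.ncard_le_ncard b1 hVf
      have b3 := Set.ncard_insert_of_notMem (fun h : C ∈ S => h.2 hyC) hSf
      have b4 := Set.ncard_le_ncard hPsub (hNfin.image _)
      have b5 := Set.ncard_image_le (f := compOutside (A ∪ {y})) hNfin
      omega
    · obtain ⟨n₀, hn₀, hinf⟩ : ∃ n ∈ N, ¬ (compOutside (A ∪ {y}) n).Finite := by
        by_contra! hcon
        apply hCf
        refine ((hNfin.biUnion hcon).insert y).subset ?_
        intro z hz
        rcases reach_nbr hz with h | ⟨n, hn, k⟩
        · exact .inl h
        · exact .inr (Set.mem_biUnion (show n ∈ N from hn) k)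
      have hPsub2 : P ⊆ compOutside (A ∪ {y}) '' (N \ {n₀}) := by
        rintro V ⟨hf, n, hn, rfl⟩
        exact ⟨n, ⟨hn, fun h => hinf (by rw [← Set.mem_singleton_iff.1 h]; exact hf)⟩, rfl⟩
      have b1 := Set.ncard_le_ncard hSV hVf
      have b4 := Set.ncard_le_ncard hPsub2 (hNfin.diff.image _)
      have b5 := Set.ncard_image_le (f := compOutside (A ∪ {y})) (hNfin.diff (t := {n₀}))
      have b6 := Set.ncard_diff_singleton_add_one hn₀ hNfin
      omega
  · have h1 : {V | IsVoid A V}.Infinite := Set.Infinite.mono hSV hSf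
    have h2 : {V | IsVoid (A ∪ {y}) V}.Infinite := Set.Infinite.mono hSV' hSf
    rw [h1.ncard, h2.ncard]
    constructor <;> push_cast <;> omega
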